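/- Contextuality of the outcome assignment under coordinate swap: there exist n ≥ 3, a simplex point s = Σ tᵢxᵢ and an observer point m = Σ rᵢxᵢ (all coordinates positive) such that m ∈ eig(x₁, s), but after swapping two coordinates t₂ and t₃ of s (leaving t₁ unchanged) to obtain s', one has m ∈ eig(x₂, s'). Yet the probability μ(eig(x₁, s)) = t₁ = μ(eig(x₁, s')) is unchanged. -/

import Mathlib

open Finset MeasureTheory

/-- The affine hyperplane `f = c` of a real vector space. -/
def levelAff {E : Type*} [AddCommGroup E] [Module ℝ E] (f : E →ₗ[ℝ] ℝ) (c : ℝ) :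
    AffineSubspace ℝ E where
  carrier := {w | f w = c}
  smul_vsub_vadd_mem' := by
    intro a p q r hp hq hr
    simp only [Set.mem_setOf_eq] at *
    simp [hp, hq, hr]

/-- The coordinate sum as a linear functional. -/
noncomputable def coordSum : EuclideanSpace ℝ (Fin 3) →ₗ[ℝ] ℝ where
  toFun x := ∑ i, x i
  map_add' x y := by simp [Finset.sum_add_distrib]
  map_smul' a x := by simp [Finset.mul_sum]

/-- The direction of the plane containing the simplex. -/
noncomputable abbrev dirW : Submodule ℝ (EuclideanSpace ℝ (Fin 3)) := LinearMap.ker coordSum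

theorem mem_dirW (x : EuclideanSpace ℝ (Fin 3)) : x ∈ dirW ↔ x 0 + x 1 + x 2 = 0 := by
  rw [LinearMap.mem_ker]
  change ∑ i, x i = 0 ↔ _
  rw [Fin.sum_univ_three]

theorem finrank_dirW : Module.finrank ℝ dirW = 2 := by
  have h : coordSum ≠ 0 := by
    intro h
    have := congrArg (fun f => f (EuclideanSpace.single (0 : Fin 3) (1 : ℝ))) h
    simp [coordSum] at this
  have := Module.Dual.finrank_ker_add_one_of_ne_zero (f := coordSum) h
  simp only [finrank_euclideanSpace, Fintype.card_fin] at this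
  exact Nat.succ_injective this

/-- Coordinate functionals on the direction. -/
noncomputable def coordW (i : Fin 3) : dirW →ₗ[ℝ] ℝ where
  toFun x := (x : EuclideanSpace ℝ (Fin 3)) i
  map_add' x y := by simp
  map_smul' a x := by simp

theorem coordW_apply (i : Fin 3) (w : dirW) :
    coordW i w = (w : EuclideanSpace ℝ (Fin 3)) i := rfl

/-- The base vertex. -/
noncomputable def basePt : EuclideanSpace ℝ (Fin 3) := !₂[0, 1, 0]

/-- Parametrisation of the plane. -/
noncomputable def param (w : dirW) : EuclideanSpace ℝ (Fin 3) := basePt + w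

theorem param_isometry : Isometry param :=
  (isometry_vadd _ basePt).comp isometry_subtype_coe

theorem param_apply (w : dirW) (i : Fin 3) :
    param w i = (![0, 1, 0] : Fin 3 → ℝ) i + (w : EuclideanSpace ℝ (Fin 3)) i := rfl

theorem coordW_ne (i : Fin 3) (c : ℝ) : levelAff (coordW i) c ≠ ⊤ := by
  intro h
  have hall : ∀ w : dirW, coordW i w = c := by
    intro w
    have : w ∈ (⊤ : AffineSubspace ℝ dirW) := AffineSubspace.mem_top _ _ _
    rw [← h] at this
    exact this
  have h0 := hall 0
  have h1 := hall ⟨!₂[1, 1, -2], by rw [mem_dirW]; simp; norm_num⟩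
  rw [map_zero] at h0
  rw [← h0, coordW_apply] at h1
  fin_cases i <;> simp at h1

theorem eig_measure (t : Fin 3 → ℝ) (ht : ∀ i, 0 < t i) (hs : ∑ i, t i = 1) :
    μH[((0 + 3 : ℕ) : ℝ) - 1]
            {m : EuclideanSpace ℝ (Fin 3) | (∀ i, 0 < m i) ∧ (∑ i, m i = 1) ∧
              ∀ j, j ≠ (0 : Fin 3) → t j / m j < t 0 / m 0} =
          ENNReal.ofReal (t 0) *
            μH[((0 + 3 : ℕ) : ℝ) - 1]
              {x : EuclideanSpace ℝ (Fin 3) | (∀ i, 0 ≤ x i) ∧ ∑ i, x i = 1} := by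
  have hd : ((0 + 3 : ℕ) : ℝ) - 1 = (Module.finrank ℝ dirW : ℝ) := by
    rw [finrank_dirW]; norm_num
  rw [hd]
  simp only [Fin.sum_univ_three] at hs ⊢
  set C : Set dirW := {w | ∀ i, 0 ≤ param w i} with hC
  set S : Set dirW := {w | ∀ i, 0 < param w i} with hS
  have hv : (!₂[t 0 - 1, t 1, t 2] : EuclideanSpace ℝ (Fin 3)) ∈ dirW := by
    rw [mem_dirW]; simp; linarith
  set v : dirW := ⟨_, hv⟩ with hvdef
  set L := LinearMap.transvection (coordW 0) v with hL
  have hdet : LinearMap.det L = t 0 := by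
    rw [hL, LinearMap.transvection.det, coordW_apply, hvdef]; simp
  have hLa : ∀ w i, param (L w) i = param w i + param w 0 * (![t 0 - 1, t 1, t 2] : Fin 3 → ℝ) i := by
    intro w i
    rw [hL, LinearMap.transvection.apply, param_apply, param_apply, param_apply, coordW_apply]
    simp [hvdef]
    fin_cases i <;> simp <;> ring
  have hsum : ∀ w, param w 0 + param w 1 + param w 2 = 1 := by
    intro w
    have := (mem_dirW _).1 w.2
    simp only [param_apply]
    simp
    linarith
  have hex : ∀ m : EuclideanSpace ℝ (Fin 3), m 0 + m 1 + m 2 = 1 → ∃ w, param w = m := by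
    intro m hm
    refine ⟨⟨m - basePt, ?_⟩, ?_⟩
    · rw [mem_dirW]; simp [basePt]; linarith
    · simp [param]
  have hCimg : {x : EuclideanSpace ℝ (Fin 3) | (∀ i, 0 ≤ x i) ∧ x 0 + x 1 + x 2 = 1}
      = param '' C := by
    ext x
    constructor
    · rintro ⟨h1, h2⟩
      obtain ⟨w, rfl⟩ := hex x h2
      exact ⟨w, h1, rfl⟩
    · rintro ⟨w, h1, rfl⟩
      exact ⟨h1, hsum w⟩
  have hEimg : {m : EuclideanSpace ℝ (Fin 3) | (∀ i, 0 < m i) ∧ (m 0 + m 1 + m 2 = 1) ∧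
              ∀ j, j ≠ (0 : Fin 3) → t j / m j < t 0 / m 0} = param '' (L '' S) := by
    ext m
    constructor
    · rintro ⟨h1, h2, h3⟩
      have a1 := h3 1 (by decide)
      have a2 := h3 2 (by decide)
      rw [div_lt_div_iff₀ (h1 _) (h1 _)] at a1 a2
      have ht0 := ht 0
      obtain ⟨w, hw⟩ := hex !₂[m 0 / t 0, m 1 - t 1 * (m 0 / t 0), m 2 - t 2 * (m 0 / t 0)] (by
        have e : m 0 = t 0 * (m 0 / t 0) := by field_simp
        have e' : t 0 * (m 0 / t 0) + m 1 + m 2 = 1 := by rw [← e]; exact h2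
        simp
        linear_combination e' + (-(m 0 / t 0)) * hs)
      refine ⟨L w, ⟨w, ?_, rfl⟩, ?_⟩
      · intro i
        rw [hw]
        have b0 : 0 < m 0 / t 0 := div_pos (h1 0) ht0
        have b1 : 0 < m 1 - t 1 * (m 0 / t 0) := by
          rw [← mul_div_assoc, sub_pos, div_lt_iff₀ ht0]; linarith
        have b2 : 0 < m 2 - t 2 * (m 0 / t 0) := by
          rw [← mul_div_assoc, sub_pos, div_lt_iff₀ ht0]; linarith
        fin_cases i
        · simpa using b0
        · simpa using b1
        · simpa using b2
      · ext i
        rw [hLa, hw]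
        fin_cases i
        · simp; field_simp; ring
        · simp; ring
        · simp; ring
    · rintro ⟨_, ⟨w, hw, rfl⟩, rfl⟩
      have p0 := hw 0
      have p1 := hw 1
      have p2 := hw 2
      have q0 : param (L w) 0 = t 0 * param w 0 := by rw [hLa]; simp; ring
      have q1 : param (L w) 1 = param w 1 + t 1 * param w 0 := by rw [hLa]; simp; ring
      have q2 : param (L w) 2 = param w 2 + t 2 * param w 0 := by rw [hLa]; simp; ring
      have ht0 := ht 0
      have ht1 := ht 1
      have ht2 := ht 2
      have r0 : 0 < param (L w) 0 := by rw [q0]; positivity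
      have r1 : 0 < param (L w) 1 := by rw [q1]; positivity
      have r2 : 0 < param (L w) 2 := by rw [q2]; positivity
      refine ⟨?_, hsum _, ?_⟩
      · intro i; fin_cases i
        · exact r0
        · exact r1
        · exact r2
      · intro j hj
        fin_cases j
        · exact absurd rfl hj
        · change t 1 / param (L w) 1 < _
          rw [div_lt_div_iff₀ r1 r0, q0, q1]
          nlinarith [mul_pos ht0 p1]
        · change t 2 / param (L w) 2 < _
          rw [div_lt_div_iff₀ r2 r0, q0, q2]
          nlinarith [mul_pos ht0 p2]
  have hCS : μH[(Module.finrank ℝ dirW : ℝ)] C = μH[(Module.finrank ℝ dirW : ℝ)] S := by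
    apply le_antisymm
    · have hsub : C ⊆ S ∪ ⋃ i : Fin 3,
          (levelAff (coordW i) (-(![0, 1, 0] : Fin 3 → ℝ) i) : Set dirW) := by
        intro w hw
        by_cases h : w ∈ S
        · exact Or.inl h
        · right
          simp only [hS, Set.mem_setOf_eq, not_forall, not_lt] at h
          obtain ⟨i, hi⟩ := h
          refine Set.mem_iUnion.2 ⟨i, ?_⟩
          have h0 : param w i = 0 := le_antisymm hi (hw i)
          rw [param_apply] at h0
          change coordW i w = _
          rw [coordW_apply]
          linarith
      refine (measure_mono hsub).trans ((measure_union_le _ _).trans ?_)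
      rw [measure_iUnion_null (fun i => Measure.addHaar_affineSubspace _ _ (coordW_ne i _)),
        add_zero]
    · exact measure_mono fun w hw i => (hw i).le
  rw [hCimg, hEimg, param_isometry.hausdorffMeasure_image (Or.inl (by positivity)),
    param_isometry.hausdorffMeasure_image (Or.inl (by positivity)),
    Measure.addHaar_image_linearMap, hdet, abs_of_pos (ht 0), hCS]

/-- contextuality of the outcome assignment under a coordinate
swap.  There exist `n ≥ 3`, a system state `s` (coordinates `t`) and an observer
state `m` (coordinates `r`), all coordinates positive, with `m ∈ eig(x₁, s)`, yet
after swapping the 2nd and 3rd coordinates of `t` (leaving `t₁` untouched) one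
gets `m ∈ eig(x₂, s')`; nevertheless the probability
`μ(eig(x₁, s)) = t₁·μ(Δ) = μ(eig(x₁, s'))` is unchanged. -/
theorem contextual_outcome_swap :
    ∃ (n : ℕ) (t r : Fin (n + 3) → ℝ),
      (∀ i, 0 < t i) ∧ (∑ i, t i = 1) ∧ (∀ i, 0 < r i) ∧ (∑ i, r i = 1) ∧
      (∀ j, j ≠ (0 : Fin (n + 3)) → t j / r j < t 0 / r 0) ∧
      (let t' := t ∘ (Equiv.swap (1 : Fin (n + 3)) 2);
        (∀ j, j ≠ (1 : Fin (n + 3)) → t' j / r j < t' 1 / r 1) ∧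
        t' 0 = t 0 ∧
        μH[((n + 3 : ℕ) : ℝ) - 1]
            {m : EuclideanSpace ℝ (Fin (n + 3)) | (∀ i, 0 < m i) ∧ (∑ i, m i = 1) ∧
              ∀ j, j ≠ (0 : Fin (n + 3)) → t j / m j < t 0 / m 0} =
          μH[((n + 3 : ℕ) : ℝ) - 1]
            {m : EuclideanSpace ℝ (Fin (n + 3)) | (∀ i, 0 < m i) ∧ (∑ i, m i = 1) ∧
              ∀ j, j ≠ (0 : Fin (n + 3)) → t' j / m j < t' 0 / m 0} ∧
        μH[((n + 3 : ℕ) : ℝ) - 1]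
            {m : EuclideanSpace ℝ (Fin (n + 3)) | (∀ i, 0 < m i) ∧ (∑ i, m i = 1) ∧
              ∀ j, j ≠ (0 : Fin (n + 3)) → t j / m j < t 0 / m 0} =
          ENNReal.ofReal (t 0) *
            μH[((n + 3 : ℕ) : ℝ) - 1]
              {x : EuclideanSpace ℝ (Fin (n + 3)) | (∀ i, 0 ≤ x i) ∧ ∑ i, x i = 1}) := by
  have hswap0 : Equiv.swap (1 : Fin 3) 2 0 = 0 := by decide
  refine ⟨0, ![1/3, 1/6, 1/2], ![1/4, 1/5, 11/20], ?_, ?_, ?_, ?_, ?_, ?_, ?_, ?_, ?_⟩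
  · intro i; fin_cases i <;> simp
  · simp [Fin.sum_univ_three]; norm_num
  · intro i; fin_cases i <;> simp
  · simp [Fin.sum_univ_three]; norm_num
  · intro j hj
    fin_cases j
    · exact absurd rfl hj
    · simp; norm_num
    · simp; norm_num
  · intro j hj
    fin_cases j
    · simp [Function.comp, hswap0]; norm_num
    · exact absurd rfl hj
    · simp [Function.comp]; norm_num
  · simp [hswap0]
  · refine (eig_measure _ ?_ ?_).trans (Eq.trans ?_ (eig_measure _ ?_ ?_).symm)
    · intro i; fin_cases i <;> simp
    · simp [Fin.sum_univ_three]; norm_num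
    · simp [hswap0]
    · intro i; fin_cases i <;> simp [hswap0]
    · simp [Fin.sum_univ_three, hswap0]; norm_num
  · refine eig_measure _ ?_ ?_
    · intro i; fin_cases i <;> simp
    · simp [Fin.sum_univ_three]; norm_num
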